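/- Let T > 0, s ∈ (1,2) and p ∈ G_s[0,T]. Then for every t ∈ [0,T] the series (L_2 p)(t) = Σ_{k≥0} h_k'(L) p^{(2k)}(t) converges, the function y_1 = L_2 p is infinitely differentiable on [0,T] with y_1^{(n)}(t) = Σ_{k≥0} h_k'(L) p^{(2k+n)}(t) for every integer n ≥ 0, and y_1 ∈ G_s[0,T], i.e., there exists C > 0 such that sup_{t∈[0,T]} |y_1^{(n)}(t)| ≤ C^{n+1} (n!)^s for all integers n ≥ 0. -/

import Mathlib

open Set Filter intervalIntegral

/-- The generating functions `g_k` of the beam model, defined by iterated integrals. -/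
noncomputable def genG (ρ EI : ℝ → ℝ) (m : ℝ) : ℕ → ℝ → ℝ
  | 0 => fun _ => 1
  | 1 => fun x =>
      -(∫ s₁ in (0:ℝ)..x, ∫ s₂ in (0:ℝ)..s₁, ∫ s₃ in (0:ℝ)..s₂, ∫ s₄ in (0:ℝ)..s₃,
          ρ s₄ / EI s₂)
      - m * ∫ s₁ in (0:ℝ)..x, ∫ s₂ in (0:ℝ)..s₁, ∫ _s₃ in (0:ℝ)..s₂, 1 / EI s₂
  | (k + 2) => fun x =>
      -(∫ s₁ in (0:ℝ)..x, ∫ s₂ in (0:ℝ)..s₁, ∫ s₃ in (0:ℝ)..s₂, ∫ s₄ in (0:ℝ)..s₃,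
          ρ s₄ * genG ρ EI m (k + 1) s₄ / EI s₂)

/-- The generating functions `h_k` of the beam model, defined by iterated integrals. -/
noncomputable def genH (ρ EI : ℝ → ℝ) (J : ℝ) : ℕ → ℝ → ℝ
  | 0 => fun x => x
  | 1 => fun x =>
      -(∫ s₁ in (0:ℝ)..x, ∫ s₂ in (0:ℝ)..s₁, ∫ s₃ in (0:ℝ)..s₂, ∫ s₄ in (0:ℝ)..s₃,
          s₄ * ρ s₄ / EI s₂)
      + J * ∫ s₁ in (0:ℝ)..x, ∫ s₂ in (0:ℝ)..s₁, 1 / EI s₂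
  | (k + 2) => fun x =>
      -(∫ s₁ in (0:ℝ)..x, ∫ s₂ in (0:ℝ)..s₁, ∫ s₃ in (0:ℝ)..s₂, ∫ s₄ in (0:ℝ)..s₃,
          ρ s₄ * genH ρ EI J (k + 1) s₄ / EI s₂)

/-- Membership in the Gevrey class `G_s[0,T]`: a smooth function whose derivatives satisfy
`sup_{t ∈ [0,T]} |y⁽ᵐ⁾(t)| ≤ D^(m+1) (m!)^s` for some `D > 0`. -/
def MemGevrey (s T : ℝ) (y : ℝ → ℝ) : Prop :=
  ContDiff ℝ (⊤ : ℕ∞) y ∧ ∃ D > 0, ∀ (n : ℕ), ∀ t ∈ Set.Icc (0:ℝ) T,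
    |iteratedDeriv n y t| ≤ D ^ (n + 1) * (n.factorial : ℝ) ^ s

/-- the third-order inner operator -/
noncomputable def opV (EI φ : ℝ → ℝ) (x : ℝ) : ℝ :=
  ∫ s₂ in (0:ℝ)..x, ∫ s₃ in (0:ℝ)..s₂, ∫ s₄ in (0:ℝ)..s₃, φ s₄ / EI s₂

lemma cont_prim {f : ℝ → ℝ} (hf : Continuous f) : Continuous (fun x => ∫ t in (0:ℝ)..x, f t) :=
  intervalIntegral.continuous_primitive (fun a b => hf.intervalIntegrable a b) 0

lemma opV_eq (EI φ : ℝ → ℝ) (x : ℝ) : opV EI φ x =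
    ∫ s₂ in (0:ℝ)..x, (∫ s₃ in (0:ℝ)..s₂, ∫ s₄ in (0:ℝ)..s₃, φ s₄) / EI s₂ := by
  unfold opV
  simp only [intervalIntegral.integral_div]

lemma opV_cont {EI φ : ℝ → ℝ} (hE : Continuous EI) (hE0 : ∀ x, EI x ≠ 0) (hφ : Continuous φ) :
    Continuous (opV EI φ) := by
  have : opV EI φ = fun x => ∫ s₂ in (0:ℝ)..x,
      (∫ s₃ in (0:ℝ)..s₂, ∫ s₄ in (0:ℝ)..s₃, φ s₄) / EI s₂ := funext (opV_eq EI φ)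
  rw [this]
  exact cont_prim ((cont_prim (cont_prim hφ)).div hE hE0)

lemma prim_bound {f : ℝ → ℝ} {L C : ℝ} {n : ℕ}
    (h : ∀ x ∈ Set.Icc (0:ℝ) L, |f x| ≤ C * (x ^ n / n.factorial)) :
    ∀ x ∈ Set.Icc (0:ℝ) L, |∫ t in (0:ℝ)..x, f t| ≤ C * (x ^ (n + 1) / (n + 1).factorial) := by
  intro x hx
  have h1 : ‖∫ t in (0:ℝ)..x, f t‖ ≤ ∫ t in (0:ℝ)..x, C * (t ^ n / n.factorial) := by
    apply intervalIntegral.norm_integral_le_of_norm_le hx.1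
    · refine Filter.Eventually.of_forall ?_
      intro t ht
      exact h t ⟨ht.1.le, ht.2.trans hx.2⟩
    · apply Continuous.intervalIntegrable
      fun_prop
  rw [Real.norm_eq_abs] at h1
  refine h1.trans (le_of_eq ?_)
  rw [intervalIntegral.integral_const_mul, intervalIntegral.integral_div, integral_pow,
    Nat.factorial_succ]
  have : (n.factorial : ℝ) ≠ 0 := by positivity
  have : (n : ℝ) + 1 ≠ 0 := by positivity
  push_cast
  field_simp
  simp

lemma opV_bound {EI φ : ℝ → ℝ} {L C c : ℝ} {n : ℕ} (hc : 0 < c) (hE : ∀ x, c ≤ EI x)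
    (h : ∀ x ∈ Set.Icc (0:ℝ) L, |φ x| ≤ C * (x ^ n / n.factorial)) :
    ∀ x ∈ Set.Icc (0:ℝ) L, |opV EI φ x| ≤ C / c * (x ^ (n + 3) / (n + 3).factorial) := by
  intro x hx
  rw [opV_eq]
  refine prim_bound (n := n + 2) (C := C / c) (L := L) ?_ x hx
  intro y hy
  have h2 := prim_bound (prim_bound h) y hy
  have hEy := hE y
  have hEp : 0 < EI y := hc.trans_le hEy
  rw [abs_div, abs_of_pos hEp, div_mul_eq_mul_div]
  exact div_le_div₀ ((abs_nonneg _).trans h2) h2 hc hEy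

lemma genH_one (ρ EI : ℝ → ℝ) (J : ℝ) : genH ρ EI J 1 = fun x =>
    -(∫ s in (0:ℝ)..x, opV EI (fun t => t * ρ t) s) +
      J * ∫ s₁ in (0:ℝ)..x, ∫ s₂ in (0:ℝ)..s₁, 1 / EI s₂ := by
  funext x
  simp only [genH, opV]

lemma genH_succ (ρ EI : ℝ → ℝ) (J : ℝ) (k : ℕ) : genH ρ EI J (k + 2) = fun x =>
    -∫ s in (0:ℝ)..x, opV EI (fun t => ρ t * genH ρ EI J (k + 1) t) s := by
  funext x
  simp only [genH, opV]

lemma genH_cont {ρ EI : ℝ → ℝ} (J : ℝ) (hρ : Continuous ρ) (hE : Continuous EI)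
    (hE0 : ∀ x, EI x ≠ 0) : ∀ k, Continuous (genH ρ EI J k)
  | 0 => by simp only [genH]; exact continuous_id
  | 1 => by
      rw [genH_one]
      have h1 := cont_prim (opV_cont hE hE0 (continuous_id.mul hρ))
      have h2 : Continuous fun x => 1 / EI x := continuous_const.div hE hE0
      exact h1.neg.add (continuous_const.mul (cont_prim (cont_prim h2)))
  | (k + 2) => by
      rw [genH_succ]
      exact (cont_prim (opV_cont hE hE0 (hρ.mul (genH_cont J hρ hE hE0 (k + 1))))).neg

lemma genH_bound {ρ EI : ℝ → ℝ} {J c R L C : ℝ} (hc : 0 < c) (hE : ∀ x, c ≤ EI x)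
    (hR : ∀ x, |ρ x| ≤ R) (h1 : ∀ x ∈ Set.Icc (0:ℝ) L, |genH ρ EI J 1 x| ≤ C) (k : ℕ) :
    ∀ x ∈ Set.Icc (0:ℝ) L, |genH ρ EI J (k + 1) x| ≤
      C * (R / c) ^ k * (x ^ (4 * k) / (4 * k).factorial) := by
  induction k with
  | zero => intro x hx; simpa using h1 x hx
  | succ k ih =>
    intro x hx
    rw [genH_succ]
    dsimp only
    rw [abs_neg]
    have hφ : ∀ x ∈ Set.Icc (0:ℝ) L, |ρ x * genH ρ EI J (k + 1) x| ≤
        R * (C * (R / c) ^ k) * (x ^ (4 * k) / (4 * k).factorial) := by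
      intro x hx
      rw [abs_mul, mul_assoc]
      exact mul_le_mul (hR x) (ih x hx) (abs_nonneg _) ((abs_nonneg _).trans (hR x))
    have := prim_bound (opV_bound hc hE hφ) x hx
    rw [show 4 * (k + 1) = 4 * k + 3 + 1 by ring]
    refine this.trans (le_of_eq ?_)
    rw [pow_succ (R / c)]
    ring

lemma genH_deriv_bound {ρ EI : ℝ → ℝ} {J c R L C : ℝ} (hL : 0 < L) (hc : 0 < c)
    (hρ : Continuous ρ) (hEc : Continuous EI) (hE : ∀ x, c ≤ EI x)
    (hR : ∀ x, |ρ x| ≤ R) (h1 : ∀ x ∈ Set.Icc (0:ℝ) L, |genH ρ EI J 1 x| ≤ C) (k : ℕ) :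
    |derivWithin (genH ρ EI J (k + 2)) (Set.Icc 0 L) L| ≤
      C * (R / c) ^ (k + 1) * (L ^ (4 * k + 3) / (4 * k + 3).factorial) := by
  have hE0 : ∀ x, EI x ≠ 0 := fun x => (hc.trans_le (hE x)).ne'
  have hcont := opV_cont hEc hE0 (hρ.mul (genH_cont J hρ hEc hE0 (k + 1)))
  have hd : HasDerivAt (genH ρ EI J (k + 2))
      (-(opV EI (fun t => ρ t * genH ρ EI J (k + 1) t) L)) L := by
    rw [genH_succ]
    exact (hcont.integral_hasStrictDerivAt 0 L).hasDerivAt.neg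
  rw [hd.hasDerivWithinAt.derivWithin
    (uniqueDiffOn_Icc hL L (Set.right_mem_Icc.2 hL.le)), abs_neg]
  have hφ : ∀ x ∈ Set.Icc (0:ℝ) L, |ρ x * genH ρ EI J (k + 1) x| ≤
      R * (C * (R / c) ^ k) * (x ^ (4 * k) / (4 * k).factorial) := by
    intro x hx
    rw [abs_mul, mul_assoc]
    exact mul_le_mul (hR x) (genH_bound hc hE hR h1 k x hx) (abs_nonneg _)
      ((abs_nonneg _).trans (hR x))
  refine (opV_bound hc hE hφ L (Set.right_mem_Icc.2 hL.le)).trans (le_of_eq ?_)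
  rw [pow_succ (R / c)]
  ring

lemma int_congr0 {f g : ℝ → ℝ} {L : ℝ} (h : ∀ x ∈ Set.Icc (0:ℝ) L, f x = g x) :
    ∀ x ∈ Set.Icc (0:ℝ) L, ∫ t in (0:ℝ)..x, f t = ∫ t in (0:ℝ)..x, g t := by
  intro x hx
  apply intervalIntegral.integral_congr
  intro t ht
  rw [Set.uIcc_of_le hx.1] at ht
  exact h t ⟨ht.1, ht.2.trans hx.2⟩

lemma opV_congr {EI EI' φ φ' : ℝ → ℝ} {L : ℝ} (hE : ∀ x ∈ Set.Icc (0:ℝ) L, EI x = EI' x)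
    (h : ∀ x ∈ Set.Icc (0:ℝ) L, φ x = φ' x) :
    ∀ x ∈ Set.Icc (0:ℝ) L, opV EI φ x = opV EI' φ' x := by
  intro x hx
  rw [opV_eq, opV_eq]
  refine int_congr0 (L := L) ?_ x hx
  intro y hy
  rw [hE y hy, int_congr0 (int_congr0 h) y hy]

lemma genH_congr {ρ ρ' EI EI' : ℝ → ℝ} {L : ℝ} (J : ℝ)
    (hρ : ∀ x ∈ Set.Icc (0:ℝ) L, ρ x = ρ' x)
    (hE : ∀ x ∈ Set.Icc (0:ℝ) L, EI x = EI' x) :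
    ∀ k, ∀ x ∈ Set.Icc (0:ℝ) L, genH ρ EI J k x = genH ρ' EI' J k x
  | 0 => by intro x _; simp only [genH]
  | 1 => by
      intro x hx
      rw [genH_one, genH_one]
      dsimp only
      rw [int_congr0 (opV_congr hE (φ := fun t => t * ρ t) (φ' := fun t => t * ρ' t)
          (fun y hy => by simp only [hρ y hy])) x hx,
        int_congr0 (int_congr0 (f := fun t => 1 / EI t) (g := fun t => 1 / EI' t)
          (fun y hy => by simp only [hE y hy])) x hx]
  | (k + 2) => by
      intro x hx
      rw [genH_succ, genH_succ]
      dsimp only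
      rw [int_congr0 (opV_congr hE (φ' := fun t => ρ' t * genH ρ' EI' J (k + 1) t)
          (fun y hy => by simp only [hρ y hy, genH_congr J hρ hE (k + 1) y hy])) x hx]

lemma coef_bound {ρ EI : ℝ → ℝ} {L : ℝ} (J : ℝ) (hL : 0 < L)
    (hρ : ContinuousOn ρ (Set.Icc 0 L)) (hEI : ContinuousOn EI (Set.Icc 0 L))
    (hEIpos : ∃ c > 0, ∀ x ∈ Set.Icc (0:ℝ) L, c ≤ EI x) :
    ∃ K > 0, ∃ B > 0, ∀ k : ℕ, |derivWithin (genH ρ EI J (k + 2)) (Set.Icc 0 L) L| ≤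
      K * B ^ k / (4 * k).factorial := by
  obtain ⟨c, hc, hE⟩ := hEIpos
  set ρ' : ℝ → ℝ := Set.IccExtend hL.le (Set.restrict (Set.Icc 0 L) ρ) with hρ'
  set EI' : ℝ → ℝ := Set.IccExtend hL.le (Set.restrict (Set.Icc 0 L) EI) with hEI'
  have e1 : ∀ x ∈ Set.Icc (0:ℝ) L, ρ x = ρ' x := by
    intro x hx; rw [hρ', Set.IccExtend_of_mem _ _ hx]; rfl
  have e2 : ∀ x ∈ Set.Icc (0:ℝ) L, EI x = EI' x := by
    intro x hx; rw [hEI', Set.IccExtend_of_mem _ _ hx]; rfl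
  have c1 : Continuous ρ' := hρ.restrict.Icc_extend'
  have c2 : Continuous EI' := hEI.restrict.Icc_extend'
  have hE' : ∀ x, c ≤ EI' x := fun x => hE _ (Set.projIcc 0 L hL.le x).2
  have hE0 : ∀ x, EI' x ≠ 0 := fun x => (hc.trans_le (hE' x)).ne'
  obtain ⟨R, hR⟩ := isCompact_Icc.exists_bound_of_continuousOn hρ
  have hR' : ∀ x, |ρ' x| ≤ |R| + 1 := fun x => by
    have := hR _ (Set.projIcc 0 L hL.le x).2
    have h2 := le_abs_self R
    have h3 : |ρ' x| ≤ R := this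
    linarith
  obtain ⟨C, hC⟩ := (isCompact_Icc (a := (0:ℝ)) (b := L)).exists_bound_of_continuousOn
    (genH_cont J c1 c2 hE0 1).continuousOn
  have hC' : ∀ x ∈ Set.Icc (0:ℝ) L, |genH ρ' EI' J 1 x| ≤ |C| + 1 := fun x hx => by
    have h3 : |genH ρ' EI' J 1 x| ≤ C := hC x hx
    have h2 := le_abs_self C
    linarith
  refine ⟨(|C| + 1) * ((|R| + 1) / c) * L ^ 3, by positivity, ((|R| + 1) / c) * L ^ 4,
    by positivity, fun k => ?_⟩
  rw [derivWithin_congr (genH_congr J e1 e2 (k + 2))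
    (genH_congr J e1 e2 (k + 2) L (Set.right_mem_Icc.2 hL.le))]
  refine (genH_deriv_bound hL hc c1 c2 hE' hR' hC' k).trans ?_
  have hfac : (((4 * k).factorial : ℕ) : ℝ) ≤ ((4 * k + 3).factorial : ℕ) := by
    exact_mod_cast Nat.factorial_le (by omega)
  calc _ = (|C| + 1) * ((|R| + 1) / c) * L ^ 3 * (((|R| + 1) / c) * L ^ 4) ^ k /
        (4 * k + 3).factorial := by
        rw [mul_pow ((|R| + 1) / c), ← pow_mul, pow_add L, pow_succ ((|R| + 1) / c)]; ring
    _ ≤ _ := by gcongr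

lemma coef_bound' (a : ℕ → ℝ) (h : ∃ K > 0, ∃ B > 0, ∀ k : ℕ, |a (k + 2)| ≤
      K * B ^ k / (4 * k).factorial) :
    ∃ K > 0, ∃ B > 0, ∀ k : ℕ, |a k| * ((2 * k).factorial : ℝ) ^ 2 ≤ K * B ^ (2 * k) := by
  obtain ⟨K, hK, B, hB, h⟩ := h
  have key : ∀ k : ℕ, |a (k + 2)| * ((2 * (k + 2)).factorial : ℝ) ^ 2 ≤
      K * 24 ^ 2 * 2 ^ 8 * (16 * (B + 1)) ^ k := by
    intro k
    have f1 : (2 * (k + 2)).factorial ≤ 2 ^ (2 * k + 4) * ((2 * k).factorial * 24) := by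
      have := Nat.add_choose_mul_factorial_mul_factorial (2 * k) 4
      have h2 := Nat.choose_le_two_pow (2 * k + 4) 4
      rw [show 2 * (k + 2) = 2 * k + 4 by ring, ← this, mul_assoc]
      exact Nat.mul_le_mul h2 le_rfl
    have f2 : (2 * k).factorial * (2 * k).factorial ≤ (4 * k).factorial := by
      have := Nat.factorial_mul_factorial_dvd_factorial_add (2 * k) (2 * k)
      rw [show 2 * k + 2 * k = 4 * k by ring] at this
      exact Nat.le_of_dvd (Nat.factorial_pos _) this
    have f1' : ((2 * (k + 2)).factorial : ℝ) ≤ 2 ^ (2 * k + 4) * ((2 * k).factorial * 24) := by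
      exact_mod_cast f1
    have f2' : ((2 * k).factorial : ℝ) * (2 * k).factorial ≤ (4 * k).factorial := by
      exact_mod_cast f2
    calc |a (k + 2)| * ((2 * (k + 2)).factorial : ℝ) ^ 2
        ≤ (K * B ^ k / (4 * k).factorial) * (2 ^ (2 * k + 4) * ((2 * k).factorial * 24)) ^ 2 := by
          gcongr
          exact h k
      _ = K * B ^ k * 24 ^ 2 * 2 ^ 8 * 16 ^ k *
          (((2 * k).factorial : ℝ) * (2 * k).factorial / (4 * k).factorial) := by
          rw [pow_add, pow_mul 2 2 k, show (16:ℝ) ^ k = (2 ^ 2) ^ k * (2 ^ 2) ^ k by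
            rw [← mul_pow]; norm_num]
          ring
      _ ≤ K * (B + 1) ^ k * 24 ^ 2 * 2 ^ 8 * 16 ^ k * 1 := by
          gcongr
          · linarith
          · rw [div_le_one (by positivity)]; exact f2'
      _ = _ := by rw [mul_pow]; ring
  refine ⟨K * 24 ^ 2 * 2 ^ 8 + |a 0| + 4 * |a 1|, by positivity, 16 * (B + 1), by positivity, ?_⟩
  have hB1 : 1 ≤ 16 * (B + 1) := by linarith
  have hb : ∀ j, 1 ≤ (16 * (B + 1)) ^ j := fun j => one_le_pow₀ hB1
  have a0 := abs_nonneg (a 0)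
  have a1 := abs_nonneg (a 1)
  intro k
  match k with
  | 0 => simp; nlinarith
  | 1 =>
    have := hb 2
    norm_num
    nlinarith
  | (k + 2) =>
    refine (key k).trans ?_
    have : (16 * (B + 1)) ^ k ≤ (16 * (B + 1)) ^ (2 * (k + 2)) :=
      pow_le_pow_right₀ hB1 (by omega)
    gcongr
    nlinarith

lemma summable_aux (B ε : ℝ) (hB : 0 < B) (hε : 0 < ε) :
    Summable (fun n : ℕ => B ^ n * (n.factorial : ℝ) ^ (-ε)) := by
  set c : ℝ := (2 * B) ^ (1 / ε) with hc
  have h0 := FloorSemiring.tendsto_pow_div_factorial_atTop c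
  obtain ⟨M, hM⟩ := h0.bddAbove_range
  have hcpos : 0 < c := by positivity
  have hM' : ∀ n : ℕ, c ^ n / n.factorial ≤ |M| := fun n =>
    (hM ⟨n, rfl⟩).trans (le_abs_self M)
  refine Summable.of_nonneg_of_le (fun n => by positivity) (fun n => ?_)
    ((summable_geometric_two).mul_left (|M| ^ ε))
  have h1 : (c ^ n / n.factorial) ^ ε ≤ |M| ^ ε :=
    Real.rpow_le_rpow (by positivity) (hM' n) hε.le
  have h2 : (c ^ n / n.factorial) ^ ε = (2 * B) ^ n * (n.factorial : ℝ) ^ (-ε) := by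
    rw [Real.div_rpow (by positivity) (by positivity), Real.rpow_neg (by positivity),
      ← Real.rpow_natCast c, ← Real.rpow_mul hcpos.le, hc, ← Real.rpow_mul (by positivity),
      show 1 / ε * (n * ε) = n by field_simp, Real.rpow_natCast]
    rfl
  rw [h2, mul_pow] at h1
  rw [one_div, inv_pow, ← div_eq_mul_inv, le_div_iff₀ (by positivity)]
  linarith

/-- master summability/bound -/
lemma master (a : ℕ → ℝ) (s D : ℝ) (hs1 : 1 < s) (hs2 : s < 2) (hD : 0 < D)
    (h : ∃ K > 0, ∃ B > 0, ∀ k : ℕ, |a k| * ((2 * k).factorial : ℝ) ^ 2 ≤ K * B ^ (2 * k)) :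
    ∃ b : ℕ → ℝ, Summable b ∧ (∀ k, 0 ≤ b k) ∧ ∀ n k : ℕ,
      |a k| * (D ^ (2 * k + n + 1) * ((2 * k + n).factorial : ℝ) ^ s) ≤
        b k * ((D * 2 ^ s) ^ n * (n.factorial : ℝ) ^ s) := by
  obtain ⟨K, hK, B, hB, h⟩ := h
  have hsum := (summable_aux (B * (D * 2 ^ s)) (2 - s) (by positivity) (by linarith)).comp_injective
    (i := fun k : ℕ => 2 * k) (fun x y h => by simpa using h)
  refine ⟨_, hsum.mul_left (K * D), fun k => by simp only [Function.comp]; positivity, ?_⟩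
  intro n k
  simp only [Function.comp]
  have f1 : (2 * k + n).factorial ≤ 2 ^ (2 * k + n) * ((2 * k).factorial * n.factorial) := by
    have := Nat.add_choose_mul_factorial_mul_factorial (2 * k) n
    have h2 := Nat.choose_le_two_pow (2 * k + n) n
    rw [← this, mul_assoc]
    exact Nat.mul_le_mul h2 le_rfl
  have f1' : ((2 * k + n).factorial : ℝ) ≤ 2 ^ (2 * k + n) * ((2 * k).factorial * n.factorial) := by
    exact_mod_cast f1
  have f2 : ((2 * k + n).factorial : ℝ) ^ s ≤
      (2 ^ s) ^ (2 * k + n) * (((2 * k).factorial : ℝ) ^ s * (n.factorial : ℝ) ^ s) := by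
    refine (Real.rpow_le_rpow (by positivity) f1' (by linarith)).trans (le_of_eq ?_)
    rw [Real.mul_rpow (by positivity) (by positivity), Real.mul_rpow (by positivity) (by positivity)]
    congr 1
    rw [← Real.rpow_natCast, ← Real.rpow_mul (by norm_num), mul_comm, Real.rpow_mul (by norm_num),
      Real.rpow_natCast]
  have f3 : ((2 * k).factorial : ℝ) ^ s =
      ((2 * k).factorial : ℝ) ^ 2 * ((2 * k).factorial : ℝ) ^ (-(2 - s)) := by
    rw [← Real.rpow_natCast, ← Real.rpow_add (by positivity)]
    congr 1
    push_cast; ring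
  calc _ ≤ |a k| * (D ^ (2 * k + n + 1) *
        ((2 ^ s) ^ (2 * k + n) * (((2 * k).factorial : ℝ) ^ s * (n.factorial : ℝ) ^ s))) := by
        gcongr
    _ = (|a k| * ((2 * k).factorial : ℝ) ^ 2) * (D * (D * 2 ^ s) ^ (2 * k) *
        ((2 * k).factorial : ℝ) ^ (-(2 - s)) * ((D * 2 ^ s) ^ n * (n.factorial : ℝ) ^ s)) := by
        rw [f3, mul_pow, mul_pow]; ring
    _ ≤ (K * B ^ (2 * k)) * (D * (D * 2 ^ s) ^ (2 * k) *
        ((2 * k).factorial : ℝ) ^ (-(2 - s)) * ((D * 2 ^ s) ^ n * (n.factorial : ℝ) ^ s)) := by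
        exact mul_le_mul_of_nonneg_right (h k) (by positivity)
    _ = _ := by rw [mul_pow B]; ring

/-- termwise differentiation on a compact interval -/
lemma tsum_deriv {T : ℝ} (hT : 0 < T) (f f' : ℕ → ℝ → ℝ) (u : ℕ → ℝ) (hu : Summable u)
    (hf : ∀ k t, HasDerivAt (f k) (f' k t) t) (hf' : ∀ k, Continuous (f' k))
    (hb : ∀ k, ∀ t ∈ Set.Icc (0:ℝ) T, |f' k t| ≤ u k)
    (hs : ∀ t ∈ Set.Icc (0:ℝ) T, Summable fun k => f k t) :
    ∀ t ∈ Set.Icc (0:ℝ) T, HasDerivWithinAt (fun t => ∑' k, f k t) (∑' k, f' k t)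
      (Set.Icc 0 T) t := by
  set g' : ℕ → ℝ → ℝ := fun k t => f' k (Set.projIcc 0 T hT.le t) with hg'
  have hg'c : ∀ k, Continuous (g' k) := fun k =>
    (hf' k).comp (continuous_subtype_val.comp continuous_projIcc)
  set g : ℕ → ℝ → ℝ := fun k t => f k 0 + ∫ x in (0:ℝ)..t, g' k x with hg
  have hgd : ∀ k t, HasDerivAt (g k) (g' k t) t := fun k t =>
    ((hg'c k).integral_hasStrictDerivAt 0 t).hasDerivAt.const_add _
  have e' : ∀ k, ∀ t ∈ Set.Icc (0:ℝ) T, g' k t = f' k t := by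
    intro k t ht
    simp only [hg', Set.projIcc_of_mem hT.le ht]
  have e : ∀ k, ∀ t ∈ Set.Icc (0:ℝ) T, g k t = f k t := by
    intro k t ht
    simp only [hg]
    rw [int_congr0 (e' k) t ht, intervalIntegral.integral_eq_sub_of_hasDerivAt
      (fun x _ => hf k x) ((hf' k).intervalIntegrable _ _)]
    ring
  have h0 : (0:ℝ) ∈ Set.Icc (0:ℝ) T := Set.left_mem_Icc.2 hT.le
  have main := hasDerivAt_tsum (y₀ := 0) hu hgd
    (fun k t => hb k _ (Set.projIcc 0 T hT.le t).2)
    ((hs 0 h0).congr (fun k => (e k 0 h0).symm))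
  intro t ht
  have := (main t).hasDerivWithinAt (s := Set.Icc 0 T)
  rw [tsum_congr (fun k => e' k t ht)] at this
  exact this.congr (fun x hx => (tsum_congr (fun k => e k x hx)).symm)
    (tsum_congr (fun k => e k t ht)).symm

lemma iter_aux {T : ℝ} (hT : 0 < T) (Y : ℕ → ℝ → ℝ)
    (h : ∀ n, ∀ t ∈ Set.Icc (0:ℝ) T, HasDerivWithinAt (Y n) (Y (n + 1) t) (Set.Icc 0 T) t) :
    ∀ n, ∀ t ∈ Set.Icc (0:ℝ) T, iteratedDerivWithin n (Y 0) (Set.Icc 0 T) t = Y n t := by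
  intro n
  induction n with
  | zero => intro t _; simp
  | succ n ih =>
    intro t ht
    rw [iteratedDerivWithin_succ, derivWithin_congr ih (ih t ht)]
    exact (h n t ht).derivWithin (uniqueDiffOn_Icc hT t ht)

/-- for `p ∈ G_s[0,T]`, the series `(L₂ p)(t) = Σ_k h_k'(L) p⁽²ᵏ⁾(t)` converges
for every `t ∈ [0,T]`, `y₁ = L₂ p` is infinitely differentiable on `[0,T]` with
`y₁⁽ⁿ⁾(t) = Σ_k h_k'(L) p⁽²ᵏ⁺ⁿ⁾(t)`, and `y₁ ∈ G_s[0,T]`, i.e. there is `C > 0` with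
`sup_{t∈[0,T]} |y₁⁽ⁿ⁾(t)| ≤ C^(n+1) (n!)^s` for all `n`. -/
theorem stmt10 (L m J : ℝ) (hL : 0 < L) (hm : 0 < m) (hJ : 0 < J)
    (ρ EI : ℝ → ℝ)
    (hρ : ContDiffOn ℝ 4 ρ (Set.Icc 0 L)) (hEI : ContDiffOn ℝ 4 EI (Set.Icc 0 L))
    (hρpos : ∃ c > 0, ∀ x ∈ Set.Icc (0:ℝ) L, c ≤ ρ x)
    (hEIpos : ∃ c > 0, ∀ x ∈ Set.Icc (0:ℝ) L, c ≤ EI x)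
    (T s : ℝ) (hT : 0 < T) (hs₁ : 1 < s) (hs₂ : s < 2)
    (p : ℝ → ℝ) (hp : MemGevrey s T p)
    (y₁ : ℝ → ℝ)
    (hy₁ : y₁ = fun t =>
      ∑' k : ℕ, derivWithin (genH ρ EI J k) (Set.Icc 0 L) L * iteratedDeriv (2 * k) p t) :
    (∀ t ∈ Set.Icc (0:ℝ) T,
      Summable (fun k : ℕ =>
        derivWithin (genH ρ EI J k) (Set.Icc 0 L) L * iteratedDeriv (2 * k) p t)) ∧
    ContDiffOn ℝ (⊤ : ℕ∞) y₁ (Set.Icc 0 T) ∧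
    (∀ (n : ℕ), ∀ t ∈ Set.Icc (0:ℝ) T,
      iteratedDerivWithin n y₁ (Set.Icc 0 T) t =
        ∑' k : ℕ, derivWithin (genH ρ EI J k) (Set.Icc 0 L) L *
          iteratedDeriv (2 * k + n) p t) ∧
    (∃ C > 0, ∀ (n : ℕ), ∀ t ∈ Set.Icc (0:ℝ) T,
      |iteratedDerivWithin n y₁ (Set.Icc 0 T) t| ≤ C ^ (n + 1) * (n.factorial : ℝ) ^ s) := by
  obtain ⟨hpc, D, hD, hDp⟩ := hp
  set a : ℕ → ℝ := fun k => derivWithin (genH ρ EI J k) (Set.Icc 0 L) L with ha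
  obtain ⟨b, hbs, hb0, hb⟩ := master a s D hs₁ hs₂ hD
    (coef_bound' a (coef_bound J hL hρ.continuousOn hEI.continuousOn hEIpos))
  have hterm : ∀ n k : ℕ, ∀ t ∈ Set.Icc (0:ℝ) T, |a k * iteratedDeriv (2 * k + n) p t| ≤
      b k * ((D * 2 ^ s) ^ n * (n.factorial : ℝ) ^ s) := by
    intro n k t ht
    rw [abs_mul]
    refine le_trans ?_ (hb n k)
    gcongr
    exact hDp (2 * k + n) t ht
  have hsumm : ∀ n : ℕ, ∀ t ∈ Set.Icc (0:ℝ) T,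
      Summable fun k => a k * iteratedDeriv (2 * k + n) p t := fun n t ht =>
    Summable.of_norm_bounded (hbs.mul_right _) (fun k => hterm n k t ht)
  have hpd : ∀ j t, HasDerivAt (iteratedDeriv j p) (iteratedDeriv (j + 1) p t) t := by
    intro j t
    rw [iteratedDeriv_succ]
    exact ((hpc.differentiable_iteratedDeriv j
      (by exact_mod_cast WithTop.coe_lt_top j)) t).hasDerivAt
  have hpcont : ∀ j, Continuous (iteratedDeriv j p) := fun j =>
    continuous_iff_continuousAt.2 fun t => (hpd j t).continuousAt
  set Y : ℕ → ℝ → ℝ := fun n t => ∑' k, a k * iteratedDeriv (2 * k + n) p t with hY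
  have hYd : ∀ n, ∀ t ∈ Set.Icc (0:ℝ) T,
      HasDerivWithinAt (Y n) (Y (n + 1) t) (Set.Icc 0 T) t := fun n =>
    tsum_deriv hT (fun k t => a k * iteratedDeriv (2 * k + n) p t)
      (fun k t => a k * iteratedDeriv (2 * k + (n + 1)) p t) _ (hbs.mul_right _)
      (fun k t => (hpd (2 * k + n) t).const_mul (a k))
      (fun k => continuous_const.mul (hpcont _))
      (fun k t ht => hterm (n + 1) k t ht) (hsumm n)
  have hy : y₁ = Y 0 := hy₁
  have hiter := iter_aux hT Y hYd
  rw [hy]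
  refine ⟨fun t ht => hsumm 0 t ht, ?_, hiter, ?_⟩
  · apply contDiffOn_of_differentiableOn_deriv
    intro n _ t ht
    exact ((hYd n t ht).differentiableWithinAt).congr (hiter n) (hiter n t ht)
  · have hS : 0 ≤ ∑' k, b k := tsum_nonneg hb0
    have hP : 0 < D * 2 ^ s := by positivity
    refine ⟨∑' k, b k + D * 2 ^ s + 1, by positivity, fun n t ht => ?_⟩
    rw [hiter n t ht]
    have h1 : ‖Y n t‖ ≤ ∑' k, b k * ((D * 2 ^ s) ^ n * (n.factorial : ℝ) ^ s) :=
      tsum_of_norm_bounded (hbs.mul_right _).hasSum (fun k => hterm n k t ht)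
    rw [tsum_mul_right, ← mul_assoc] at h1
    refine h1.trans ?_
    rw [pow_succ']
    gcongr
    · linarith
    · linarith
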